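/- There exist no real numbers m and n with n > 0 such that both m*n + 4*n - m^2 - 2*m - 4 = 0 and m^2*n^2 + 8*n^2 - 2*m^3*n + 4*m^2*n + m^4 - 4*m^3 + 12*m^2 + 16 = 0 hold simultaneously. -/

import Mathlib

/-- There are no real `m`, `n` with `n > 0` for which the leading divergent coefficients of
both the Ricci scalar and the Kretschmann scalar vanish simultaneously. -/
theorem no_simultaneous_vanishing :
    ¬ ∃ m n : ℝ, n > 0 ∧
      m * n + 4 * n - m ^ 2 - 2 * m - 4 = 0 ∧
      m ^ 2 * n ^ 2 + 8 * n ^ 2 - 2 * m ^ 3 * n + 4 * m ^ 2 * n + m ^ 4 - 4 * m ^ 3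
        + 12 * m ^ 2 + 16 = 0 := by
  rintro ⟨m, n, -, -, h⟩
  nlinarith [sq_nonneg (m * (n - m + 2)), sq_nonneg n, sq_nonneg m]
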